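/- Heat-kernel approximation of powers of Q: for every T > 0 there exists a constant C > 0 such that for every integer M_T ≥ 2 (with δt = T/M_T), every integer M ≥ 2 (with δx = 1/M), every 1 ≤ ℓ ≤ M_T − 1, and all indices j₁, j₂ ∈ ℤ/M, one has |(Q^{2ℓ})_{j₁,j₂} − ∫_ℝ φ_{j₁}(x_{j₂} + y) dγ_{2ℓδt}(y)| ≤ C (δx²/δt)(1 + |log δt|), where γ_{s} is the centered Gaussian measure on ℝ with variance s. -/

import Mathlib

open MeasureTheory ProbabilityTheory Real Finset

noncomputable section

/-- The 1-periodic hat function associated with the node `x_k = k/M`: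
the unique continuous 1-periodic function, affine on each interval between
consecutive nodes, equal to 1 at `x_k` and 0 at the other nodes. -/
def hatFn (M : ℕ) (k : ZMod M) (x : ℝ) : ℝ :=
  max 0 (1 - (M : ℝ) * |(x - (k.val : ℝ) / M) - ((round (x - (k.val : ℝ) / M) : ℤ) : ℝ)|)

/-- The piecewise linear 1-periodic interpolant of nodal values `u`. -/
def interp (M : ℕ) [NeZero M] (u : ZMod M → ℝ) (x : ℝ) : ℝ :=
  ∑ k : ZMod M, u k * hatFn M k x

/-- Discrete `ℓ²` squared norm: `δx ∑ⱼ uⱼ²` with `δx = 1/M`. -/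
def l2sq (M : ℕ) [NeZero M] (u : ZMod M → ℝ) : ℝ :=
  (1 / M : ℝ) * ∑ j : ZMod M, (u j) ^ 2

/-- Discrete `h¹` squared seminorm: `δx ∑ⱼ ((u_{j+1} - u_j)/δx)²` with `δx = 1/M`. -/
def h1sq (M : ℕ) [NeZero M] (u : ZMod M → ℝ) : ℝ :=
  (1 / M : ℝ) * ∑ j : ZMod M, ((u (j + 1) - u j) / (1 / M : ℝ)) ^ 2

/-- The matrix `Q` with entries `Q j k = ∫ φ_k(x_j + y) dγ_{δt}(y)`, `γ_{δt}` being the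
centered Gaussian measure with variance `δt`. -/
def Qmat (M : ℕ) [NeZero M] (δt : ℝ) : Matrix (ZMod M) (ZMod M) ℝ :=
  fun j k => ∫ y, hatFn M k ((j.val : ℝ) / M + y) ∂(gaussianReal 0 δt.toNNReal)

/-- The random matrix `P` with entries `P j k = φ_k(x_j + √δt G^j)`. -/
def Pmat (M : ℕ) [NeZero M] (δt : ℝ) {Ω : Type} (G : ZMod M → Ω → ℝ) (ω : Ω) :
    Matrix (ZMod M) (ZMod M) ℝ :=
  fun j k => hatFn M k ((j.val : ℝ) / M + Real.sqrt δt * G j ω)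

/-- The averaged random matrix `P̄` with entries
`P̄ j k = (1/N) ∑ₘ φ_k(x_j + √δt G^{m,j})`. -/
def Pbar (M : ℕ) [NeZero M] (δt : ℝ) (N : ℕ) {Ω : Type} (G : Fin N × ZMod M → Ω → ℝ)
    (ω : Ω) : Matrix (ZMod M) (ZMod M) ℝ :=
  fun j k => (1 / N : ℝ) * ∑ m : Fin N, hatFn M k ((j.val : ℝ) / M + Real.sqrt δt * G (m, j) ω)

/-- The sequence of averaged random matrices `P⁽ⁱ⁾` with entries
`P⁽ⁱ⁾ j k = (1/N) ∑ₘ φ_k(x_j + √δt G^{i,m,j})`. -/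
def PbarSeq (M : ℕ) [NeZero M] (δt : ℝ) (N : ℕ) {Ω : Type}
    (G : ℕ × Fin N × ZMod M → Ω → ℝ) (i : ℕ) (ω : Ω) : Matrix (ZMod M) (ZMod M) ℝ :=
  fun j k => (1 / N : ℝ) * ∑ m : Fin N, hatFn M k ((j.val : ℝ) / M + Real.sqrt δt * G (i, m, j) ω)

/-- Descending product `P^{(n-1)} ⋯ P^{(0)}` (with the convention that the empty
product is the identity matrix). -/
def prodDesc {I : Type} [Fintype I] [DecidableEq I] (P : ℕ → Matrix I I ℝ) : ℕ → Matrix I I ℝ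
  | 0 => 1
  | n + 1 => P n * prodDesc P n

/-- Descending product starting from index `a`: `prodDescFrom P a s = P^{(a+s-1)} ⋯ P^{(a)}`
(identity for `s = 0`). -/
def prodDescFrom {I : Type} [Fintype I] [DecidableEq I] (P : ℕ → Matrix I I ℝ) (a : ℕ) :
    ℕ → Matrix I I ℝ
  | 0 => 1
  | s + 1 => P (a + s) * prodDescFrom P a s

end

open scoped NNReal

/-- Heat semigroup. -/
noncomputable def heatH (v : ℝ≥0) (f : ℝ → ℝ) (x : ℝ) : ℝ := ∫ y, f (x + y) ∂(gaussianReal 0 v)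

/-- Cameron-Martin weight. -/
noncomputable def cmE (v : ℝ≥0) (a y : ℝ) : ℝ := Real.exp ((a / v) * y - a ^ 2 / (2 * v))

lemma cmE_zero (v : ℝ≥0) (y : ℝ) : cmE v 0 y = 1 := by simp [cmE]

lemma cmE_mul (v : ℝ≥0) (a b y : ℝ) : cmE v a y * cmE v b y =
    Real.exp (-(a ^ 2 + b ^ 2) / (2 * v)) * Real.exp (((a + b) / v) * y) := by
  rw [cmE, cmE, ← Real.exp_add, ← Real.exp_add]
  congr 1
  ring

lemma cmE_integrable (v : ℝ≥0) (a b : ℝ) :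
    Integrable (fun y => cmE v a y * cmE v b y) (gaussianReal 0 v) := by
  simp_rw [cmE_mul]
  exact (integrable_exp_mul_gaussianReal _).const_mul _

lemma cmE_integral (v : ℝ≥0) (hv : v ≠ 0) (a b : ℝ) :
    ∫ y, cmE v a y * cmE v b y ∂(gaussianReal 0 v) = Real.exp (a * b / v) := by
  simp_rw [cmE_mul]
  rw [integral_const_mul]
  have h := congrFun (mgf_id_gaussianReal (μ := 0) (v := v)) ((a + b) / v)
  simp only [mgf, id] at h
  rw [h, ← Real.exp_add]
  have : (v : ℝ) ≠ 0 := by exact_mod_cast hv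
  congr 1
  field_simp
  ring

lemma heatH_shift (v : ℝ≥0) (hv : v ≠ 0) (f : ℝ → ℝ) (hf : Measurable f) (x a : ℝ) :
    heatH v f (x + a) = ∫ y, f (x + y) * cmE v a y ∂(gaussianReal 0 v) := by
  have h1 : heatH v f (x + a) = ∫ y, f (x + y) ∂(gaussianReal a v) := by
    have : gaussianReal a v = (gaussianReal 0 v).map (a + ·) := by
      rw [gaussianReal_map_const_add]; simp
    rw [this, integral_map (by fun_prop) (Measurable.aestronglyMeasurable (by fun_prop))]
    simp [heatH, add_assoc]
  rw [h1, integral_gaussianReal_eq_integral_smul hv, integral_gaussianReal_eq_integral_smul hv]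
  congr 1
  ext y
  have hv' : (v : ℝ) ≠ 0 := by exact_mod_cast hv
  have : gaussianPDFReal a v y = gaussianPDFReal 0 v y * cmE v a y := by
    rw [gaussianPDFReal, gaussianPDFReal, cmE, mul_assoc (√(2 * π * v))⁻¹, ← Real.exp_add]
    congr 2
    field_simp
    ring
  rw [this]
  simp only [smul_eq_mul]
  ring

lemma heatH_bound (v : ℝ≥0) (f : ℝ → ℝ) (c : ℝ) (hb : ∀ x, |f x| ≤ c) (x : ℝ) :
    |heatH v f x| ≤ c := by
  have := norm_integral_le_of_norm_le_const (μ := gaussianReal 0 v) (f := fun y => f (x + y))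
    (C := c) (ae_of_all _ fun y => by simpa using hb _)
  simpa [heatH] using this

lemma integrable_bdd (v : ℝ≥0) (f : ℝ → ℝ) (hf : Measurable f) (c : ℝ) (hb : ∀ x, |f x| ≤ c)
    (x : ℝ) : Integrable (fun y => f (x + y)) (gaussianReal 0 v) :=
  Integrable.of_bound (Measurable.aestronglyMeasurable (by fun_prop)) c (ae_of_all _ fun y => by simpa using hb _)

lemma heatH_nonneg (v : ℝ≥0) (f : ℝ → ℝ) (h0 : ∀ x, 0 ≤ f x) (x : ℝ) : 0 ≤ heatH v f x :=
  integral_nonneg fun _ => h0 _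

lemma heatH_measurable (v : ℝ≥0) (f : ℝ → ℝ) (hf : Measurable f) : Measurable (heatH v f) := by
  have : StronglyMeasurable (Function.uncurry fun x y => f (x + y)) := by
    apply Measurable.stronglyMeasurable
    exact hf.comp (measurable_fst.add measurable_snd)
  exact (this.integral_prod_right (ν := gaussianReal 0 v)).measurable

lemma heatH_add (s t : ℝ≥0) (f : ℝ → ℝ) (hf : Measurable f) (c : ℝ) (hb : ∀ x, |f x| ≤ c)
    (x : ℝ) : heatH (s + t) f x = heatH s (heatH t f) x := by
  have h := gaussianReal_conv_gaussianReal (m₁ := 0) (m₂ := 0) (v₁ := s) (v₂ := t)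
  rw [add_zero] at h
  unfold heatH
  rw [← h, Measure.conv, integral_map (by fun_prop) (Measurable.aestronglyMeasurable (by fun_prop)), integral_prod]
  · simp [add_assoc]
  · exact Integrable.of_bound (Measurable.aestronglyMeasurable (by fun_prop)) c (ae_of_all _ fun y => by simpa using hb _)

lemma interp_err (v : ℝ≥0) (hv : v ≠ 0) (f : ℝ → ℝ) (hf : Measurable f) (h0 : ∀ x, 0 ≤ f x)
    (h1 : ∀ x, f x ≤ 1) (x h θ : ℝ) (hθ0 : 0 ≤ θ) (hθ1 : θ ≤ 1) (hh : 0 < h) :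
    |heatH v f x - ((1 - θ) * heatH v f (x + -(θ * h)) + θ * heatH v f (x + (1 - θ) * h))|
      ≤ h ^ 2 / v := by
  have hvp : (0 : ℝ) < v := by exact_mod_cast pos_iff_ne_zero.mpr hv
  have hb : ∀ x, |f x| ≤ 1 := fun x => abs_le.mpr ⟨by linarith [h0 x], h1 x⟩
  by_cases hc : h ^ 2 ≤ v
  swap
  · have : 1 ≤ h ^ 2 / v := by rw [le_div_iff₀ hvp]; linarith
    refine le_trans ?_ this
    have e1 := heatH_nonneg v f h0
    have e2 := fun x => (abs_le.mp (heatH_bound v f 1 hb x)).2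
    rw [abs_le]
    have := e1 x
    have := e2 x
    have := mul_nonneg (sub_nonneg.mpr hθ1) (e1 (x + -(θ * h)))
    have := mul_nonneg hθ0 (e1 (x + (1 - θ) * h))
    have := mul_le_mul_of_nonneg_left (e2 (x + -(θ * h))) (sub_nonneg.mpr hθ1)
    have := mul_le_mul_of_nonneg_left (e2 (x + (1 - θ) * h)) hθ0
    constructor <;> linarith
  set a := -(θ * h) with ha
  set b := (1 - θ) * h with hb'
  set c := h ^ 2 / v with hcdef
  have hcp : 0 < c := by positivity
  have hc1 : c ≤ 1 := by rw [hcdef, div_le_one hvp]; exact hc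
  set G : ℝ → ℝ := fun y => cmE v 0 y - ((1 - θ) * cmE v a y + θ * cmE v b y) with hG
  have iE : ∀ a, Integrable (cmE v a) (gaussianReal 0 v) := fun a => by
    simpa [cmE_zero] using cmE_integrable v a 0
  have ifE : ∀ a, Integrable (fun y => f (x + y) * cmE v a y) (gaussianReal 0 v) := fun a =>
    (iE a).bdd_mul (c := 1) (Measurable.aestronglyMeasurable (by fun_prop)) (ae_of_all _ fun y => by simpa using hb _)
  have hrep : heatH v f x - ((1 - θ) * heatH v f (x + a) + θ * heatH v f (x + b)) =
      ∫ y, f (x + y) * G y ∂(gaussianReal 0 v) := by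
    have e0 : heatH v f x = heatH v f (x + 0) := by simp
    rw [e0, heatH_shift v hv f hf, heatH_shift v hv f hf, heatH_shift v hv f hf,
      ← integral_const_mul, ← integral_const_mul, ← integral_add, ← integral_sub]
    · congr 1; ext y; simp only [hG]; ring
    · exact ifE 0
    · exact ((ifE a).const_mul _).add ((ifE b).const_mul _)
    · exact (ifE a).const_mul _
    · exact (ifE b).const_mul _
  have hG2 : ∀ y, G y ^ 2 = cmE v 0 y * cmE v 0 y + (1 - θ) ^ 2 * (cmE v a y * cmE v a y)
      + θ ^ 2 * (cmE v b y * cmE v b y) + (-2 * (1 - θ)) * (cmE v 0 y * cmE v a y)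
      + (-2 * θ) * (cmE v 0 y * cmE v b y)
      + (2 * (1 - θ) * θ) * (cmE v a y * cmE v b y) := fun y => by simp only [hG]; ring
  have I := cmE_integrable v
  have i1 := I 0 0
  have i2 := i1.add ((I a a).const_mul ((1 - θ) ^ 2))
  have i3 := i2.add ((I b b).const_mul (θ ^ 2))
  have i4 := i3.add ((I 0 a).const_mul (-2 * (1 - θ)))
  have i5 := i4.add ((I 0 b).const_mul (-2 * θ))
  have i6 := i5.add ((I a b).const_mul (2 * (1 - θ) * θ))
  have iG2 : Integrable (fun y => G y ^ 2) (gaussianReal 0 v) := by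
    simp_rw [hG2]; exact i6
  have hval : ∫ y, G y ^ 2 ∂(gaussianReal 0 v) ≤ c ^ 2 := by
    simp_rw [hG2]
    have e6 := integral_add i5 ((I a b).const_mul (2 * (1 - θ) * θ))
    have e5 := integral_add i4 ((I 0 b).const_mul (-2 * θ))
    have e4 := integral_add i3 ((I 0 a).const_mul (-2 * (1 - θ)))
    have e3 := integral_add i2 ((I b b).const_mul (θ ^ 2))
    have e2 := integral_add i1 ((I a a).const_mul ((1 - θ) ^ 2))
    simp only [Pi.add_apply, integral_const_mul, cmE_integral v hv] at e2 e3 e4 e5 e6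
    rw [e6, e5, e4, e3, e2]
    have key : ∀ u : ℝ, |u| ≤ c → Real.exp u ≤ 1 + u + c ^ 2 := fun u hu => by
      have := (abs_le.mp (Real.abs_exp_sub_one_sub_id_le (hu.trans hc1))).2
      have : u ^ 2 ≤ c ^ 2 := sq_le_sq.mpr (by rwa [abs_of_pos hcp])
      linarith
    have ea : a * a / v = θ ^ 2 * c := by rw [ha, hcdef]; ring
    have eb : b * b / v = (1 - θ) ^ 2 * c := by rw [hb', hcdef]; ring
    have eab : a * b / v = -(θ * (1 - θ)) * c := by rw [ha, hb', hcdef]; ring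
    have ka := key (θ ^ 2 * c) (by
      rw [abs_of_nonneg (by positivity)]
      exact mul_le_of_le_one_left hcp.le (by nlinarith only [hθ0, hθ1]))
    have kb := key ((1 - θ) ^ 2 * c) (by
      rw [abs_of_nonneg (by positivity)]
      exact mul_le_of_le_one_left hcp.le (by nlinarith only [hθ0, hθ1]))
    have kab := key (-(θ * (1 - θ)) * c) (by
      rw [neg_mul, abs_neg, abs_of_nonneg
        (mul_nonneg (mul_nonneg hθ0 (sub_nonneg.mpr hθ1)) hcp.le)]
      exact mul_le_of_le_one_left hcp.le (by nlinarith only [hθ0, hθ1]))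
    rw [ea, eb, eab]
    simp only [zero_mul, mul_zero, zero_div, Real.exp_zero]
    have m1 := mul_le_mul_of_nonneg_left ka (sq_nonneg (1 - θ))
    have m2 := mul_le_mul_of_nonneg_left kb (sq_nonneg θ)
    have m3 := mul_le_mul_of_nonneg_left kab
      (mul_nonneg (mul_nonneg zero_le_two (sub_nonneg.mpr hθ1)) hθ0)
    have hid : 1 + (1 - θ) ^ 2 * (1 + θ ^ 2 * c + c ^ 2) + θ ^ 2 * (1 + (1 - θ) ^ 2 * c + c ^ 2)
        + -2 * (1 - θ) * 1 + -2 * θ * 1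
        + 2 * (1 - θ) * θ * (1 + -(θ * (1 - θ)) * c + c ^ 2) = c ^ 2 := by ring
    clear e2 e3 e4 e5 e6 i2 i3 i4 i5 i6 iG2 hG2
    linarith only [m1, m2, m3, hid]
  rw [hrep]
  have hpt : ∀ y, ‖f (x + y) * G y‖ ≤ (1 / (2 * c)) * G y ^ 2 + c / 2 := fun y => by
    rw [norm_mul, Real.norm_eq_abs, Real.norm_eq_abs]
    have : |f (x + y)| * |G y| ≤ |G y| := mul_le_of_le_one_left (abs_nonneg _) (hb _)
    refine this.trans ?_
    rw [← sq_abs (G y)]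
    have h2 : (1 / (2 * c)) * |G y| ^ 2 + c / 2 - |G y| = (|G y| - c) ^ 2 / (2 * c) := by
      field_simp; ring
    have : 0 ≤ (|G y| - c) ^ 2 / (2 * c) := by positivity
    linarith
  have hle := norm_integral_le_of_norm_le (μ := gaussianReal 0 v)
    ((iG2.const_mul (1 / (2 * c))).add (integrable_const (c / 2))) (ae_of_all _ hpt)
  rw [integral_add' (iG2.const_mul (1 / (2 * c))) (integrable_const (c / 2)),
    integral_const_mul] at hle
  simp only [integral_const, probReal_univ, one_smul, Real.norm_eq_abs] at hle
  refine hle.trans ?_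
  have : (1 / (2 * c)) * ∫ y, G y ^ 2 ∂(gaussianReal 0 v) ≤ (1 / (2 * c)) * c ^ 2 :=
    mul_le_mul_of_nonneg_left hval (by positivity)
  have h3 : (1 / (2 * c)) * c ^ 2 = c / 2 := by field_simp
  linarith

/-! Hat functions -/

lemma dist_round_eq (y : ℝ) (n : ℤ) (h : |y - n| ≤ 1 / 2) : |y - round y| = |y - n| := by
  apply le_antisymm (round_le y n)
  by_cases hn : round y = n
  · rw [hn]
  have h1 : (1 : ℝ) ≤ |((round y - n : ℤ) : ℝ)| := by
    exact_mod_cast Int.one_le_abs (sub_ne_zero.mpr hn)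
  push_cast at h1
  have h2 : |(round y : ℝ) - n| ≤ |y - n| + |y - round y| := by
    have := abs_sub (y - n) (y - round y)
    rwa [show (y - n) - (y - round y) = (round y : ℝ) - n by ring] at this
  linarith

lemma dist_round_neg (y : ℝ) : |-y - round (-y)| = |y - round y| := by
  have key : ∀ y : ℝ, |-y - round (-y)| ≤ |y - round y| := fun y => by
    have := round_le (-y) (-round y)
    push_cast at this
    rwa [show -y - -(round y : ℝ) = -(y - round y) by ring, abs_neg] at this
  apply le_antisymm (key y)
  simpa using key (-y)

lemma hatFn_nonneg (M : ℕ) (k : ZMod M) (x : ℝ) : 0 ≤ hatFn M k x := le_max_left _ _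

lemma hatFn_le_one (M : ℕ) (k : ZMod M) (x : ℝ) : hatFn M k x ≤ 1 := by
  apply max_le zero_le_one
  have : 0 ≤ (M : ℝ) * |(x - (k.val : ℝ) / M) - ((round (x - (k.val : ℝ) / M) : ℤ) : ℝ)| := by
    positivity
  linarith

lemma hatFn_abs_le (M : ℕ) (k : ZMod M) (x : ℝ) : |hatFn M k x| ≤ 1 := by
  rw [abs_of_nonneg (hatFn_nonneg _ _ _)]; exact hatFn_le_one _ _ _

lemma hatFn_measurable (M : ℕ) (k : ZMod M) : Measurable (hatFn M k) := by
  have hr : Measurable (fun x : ℝ => ((round x : ℤ) : ℝ)) := by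
    simp_rw [round_eq]
    fun_prop
  have hd : Measurable (fun x : ℝ => |x - ((round x : ℤ) : ℝ)|) :=
    (measurable_id.sub hr).abs
  have : Measurable (fun x : ℝ => max 0 (1 - (M : ℝ) * |x - ((round x : ℤ) : ℝ)|)) := by
    fun_prop
  exact this.comp (measurable_id.sub_const ((k.val : ℝ) / M))

lemma hatFn_periodic (M : ℕ) (k : ZMod M) (x : ℝ) : hatFn M k (x + 1) = hatFn M k x := by
  unfold hatFn
  rw [show x + 1 - (k.val : ℝ) / M = (x - (k.val : ℝ) / M) + 1 by ring, round_add_one]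
  push_cast
  congr 4
  ring

lemma hatFn_symm (M : ℕ) (i j : ZMod M) (y : ℝ) :
    hatFn M i ((j.val : ℝ) / M + y) = hatFn M j ((i.val : ℝ) / M + -y) := by
  unfold hatFn
  rw [← dist_round_neg]
  congr 4
  ring_nf

lemma val_shift (M : ℕ) [NeZero M] (j : ℤ) : ∃ n : ℤ, ((((j : ZMod M).val : ℕ) : ℤ)) = j + n * M := by
  refine ⟨-(j / M), ?_⟩
  rw [ZMod.val_intCast]
  have := Int.emod_add_mul_ediv j M
  linarith

lemma periodic_val (M : ℕ) [NeZero M] (f : ℝ → ℝ) (hf : Function.Periodic f 1) (j : ℤ) :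
    f (((j : ZMod M).val : ℝ) / M) = f ((j : ℝ) / M) := by
  obtain ⟨n, hn⟩ := val_shift M j
  have hM : (M : ℝ) ≠ 0 := by exact_mod_cast NeZero.ne M
  have hn' : (((j : ZMod M).val : ℝ)) = j + n * M := by exact_mod_cast hn
  rw [hn', add_div, mul_div_cancel_right₀ _ hM]
  simpa using hf.int_mul n ((j : ℝ) / M)

/-- Value of the hat function of index `i` (an integer representative) near `x_i`. -/
lemma hatFn_near (M : ℕ) [NeZero M] (hM2 : 2 ≤ M) (i : ℤ) (s : ℝ) (hs : |s| ≤ 1) :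
    hatFn M (i : ZMod M) ((i + s) / M) = 1 - |s| := by
  obtain ⟨n, hn⟩ := val_shift M i
  have hMp : (0 : ℝ) < M := by exact_mod_cast NeZero.pos M
  have hM2' : (2 : ℝ) ≤ M := by exact_mod_cast hM2
  have hn' : (((i : ZMod M).val : ℝ)) = i + n * M := by exact_mod_cast hn
  unfold hatFn
  have e : ((i + s) / M - (((i : ZMod M).val : ℝ)) / M) - ((-n : ℤ) : ℝ) = s / M := by
    rw [hn']; push_cast; field_simp; ring
  have e2 : |s / M| = |s| / M := by rw [abs_div, abs_of_pos hMp]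
  rw [dist_round_eq _ (-n), e, e2, mul_div_cancel₀ _ hMp.ne', max_eq_right (by linarith)]
  rw [e, e2, div_le_iff₀ hMp]
  linarith

lemma hatFn_far (M : ℕ) [NeZero M] (j : ℤ) (θ : ℝ) (h0 : 0 ≤ θ) (h1 : θ ≤ 1) (k : ZMod M)
    (hk : k ≠ (j : ZMod M)) (hk' : k ≠ ((j + 1 : ℤ) : ZMod M)) :
    hatFn M k ((j + θ) / M) = 0 := by
  have hMp : (0 : ℝ) < M := by exact_mod_cast NeZero.pos M
  unfold hatFn
  apply max_eq_left
  set n := round ((j + θ) / M - (k.val : ℝ) / M) with hn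
  set m : ℤ := j - k.val - n * M with hm
  have hkc : ((k.val : ℤ) : ZMod M) = k := by simp
  have hm0 : m ≠ 0 := fun h => hk (by
    have : ((j - k.val - n * M : ℤ) : ZMod M) = 0 := by rw [← hm, h]; simp
    push_cast at this
    simp at this
    exact (sub_eq_zero.mp this).symm)
  have hm1 : m ≠ -1 := fun h => hk' (by
    have : ((j - k.val - n * M : ℤ) : ZMod M) = -1 := by rw [← hm, h]; simp
    push_cast at this
    simp at this
    push_cast
    linear_combination -this)
  have e : (j + θ) / M - (k.val : ℝ) / M - n = (m + θ) / M := by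
    rw [hm]; push_cast; field_simp; ring
  rw [e, abs_div, abs_of_pos hMp, mul_div_cancel₀ _ hMp.ne']
  have : 1 ≤ |m + θ| := by
    rcases (by omega : 1 ≤ m ∨ m ≤ -2) with h | h
    · have : (1 : ℝ) ≤ m := by exact_mod_cast h
      rw [abs_of_nonneg (by linarith)]; linarith
    · have : (m : ℝ) ≤ -2 := by exact_mod_cast h
      rw [abs_of_nonpos (by linarith)]; linarith
  linarith

lemma interp_formula (M : ℕ) [NeZero M] (hM2 : 2 ≤ M) (f : ℝ → ℝ) (hf : Function.Periodic f 1)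
    (x : ℝ) : ∃ θ : ℝ, 0 ≤ θ ∧ θ ≤ 1 ∧ ∑ k : ZMod M, f ((k.val : ℝ) / M) * hatFn M k x =
      (1 - θ) * f (x + -(θ * (1 / M))) + θ * f (x + (1 - θ) * (1 / M)) := by
  have hMp : (0 : ℝ) < M := by exact_mod_cast NeZero.pos M
  set j := ⌊(M : ℝ) * x⌋ with hj
  set θ := Int.fract ((M : ℝ) * x) with hθ
  have h0 : 0 ≤ θ := Int.fract_nonneg _
  have h1 : θ ≤ 1 := (Int.fract_lt_one _).le
  refine ⟨θ, h0, h1, ?_⟩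
  have hx : x = (j + θ) / M := by
    rw [hj, hθ, Int.floor_add_fract]; field_simp
  have hne : (j : ZMod M) ≠ ((j + 1 : ℤ) : ZMod M) := by
    have : Fact (1 < M) := ⟨hM2⟩
    push_cast
    simp
  rw [Finset.sum_eq_add (j : ZMod M) ((j + 1 : ℤ) : ZMod M) hne]
  · rw [periodic_val M f hf, periodic_val M f hf]
    have a1 : hatFn M (j : ZMod M) x = 1 - θ := by
      rw [hx, hatFn_near M hM2 j θ (by rw [abs_of_nonneg h0]; exact h1), abs_of_nonneg h0]
    have a2 : hatFn M ((j + 1 : ℤ) : ZMod M) x = θ := by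
      rw [hx, show (j + θ : ℝ) = ((j + 1 : ℤ) : ℝ) + (θ - 1) by push_cast; ring,
        hatFn_near M hM2 (j + 1) (θ - 1) (by rw [abs_le]; constructor <;> linarith),
        abs_of_nonpos (by linarith)]
      ring
    rw [a1, a2]
    have b1 : x + -(θ * (1 / M)) = (j : ℝ) / M := by rw [hx]; ring
    have b2 : x + (1 - θ) * (1 / M) = ((j + 1 : ℤ) : ℝ) / M := by rw [hx]; push_cast; ring
    rw [b1, b2]
    ring
  · intro k _ hk
    rw [hx, hatFn_far M j θ h0 h1 k hk.1 hk.2, mul_zero]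
  · simp
  · simp

lemma hatFn_sum (M : ℕ) [NeZero M] (hM2 : 2 ≤ M) (x : ℝ) : ∑ k : ZMod M, hatFn M k x = 1 := by
  obtain ⟨θ, _, _, h⟩ := interp_formula M hM2 (fun _ => 1) (fun _ => rfl) x
  simpa using h

lemma Qmat_eq (M : ℕ) [NeZero M] (δ : ℝ) (j k : ZMod M) :
    Qmat M δ j k = heatH δ.toNNReal (hatFn M k) ((j.val : ℝ) / M) := rfl

lemma Qmat_sum_mul (M : ℕ) [NeZero M] (δ : ℝ) (j : ZMod M) (u : ZMod M → ℝ) :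
    ∑ i, Qmat M δ j i * u i =
      heatH δ.toNNReal (fun x => ∑ i, u i * hatFn M i x) ((j.val : ℝ) / M) := by
  simp_rw [Qmat_eq, heatH]
  rw [integral_finsetSum]
  · simp_rw [integral_const_mul, mul_comm]
  · intro i _
    exact (integrable_bdd _ _ (hatFn_measurable M i) 1 (hatFn_abs_le M i) _).const_mul _

lemma Qmat_row_sum (M : ℕ) [NeZero M] (hM2 : 2 ≤ M) (δ : ℝ) (j : ZMod M) :
    ∑ i, Qmat M δ j i = 1 := by
  have := Qmat_sum_mul M δ j (fun _ => 1)
  simpa [hatFn_sum M hM2, heatH] using this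

lemma main_ind (M : ℕ) [NeZero M] (hM2 : 2 ≤ M) (δ : ℝ) (hδ : 0 < δ) (k : ZMod M) (n : ℕ) :
    ∀ j : ZMod M, |(Qmat M δ ^ (n + 1)) j k
      - heatH (((n + 1 : ℕ) : ℝ≥0) * δ.toNNReal) (hatFn M k) ((j.val : ℝ) / M)|
      ≤ ((1 / M : ℝ) ^ 2 / δ) * (harmonic n : ℝ) := by
  have hMp : (0 : ℝ) < M := by exact_mod_cast NeZero.pos M
  induction n with
  | zero => intro j; simp [Qmat_eq]
  | succ n ih =>
    intro j
    set v : ℝ≥0 := ((n + 1 : ℕ) : ℝ≥0) * δ.toNNReal with hv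
    have hvr : (v : ℝ) = (n + 1) * δ := by
      rw [hv]; push_cast; rw [Real.coe_toNNReal _ hδ.le]
    have hv0 : v ≠ 0 := by
      intro h
      have : (v : ℝ) = 0 := by rw [h]; rfl
      rw [hvr] at this
      have : 0 < ((n : ℝ) + 1) * δ := by positivity
      linarith
    have hvs : ((n + 1 + 1 : ℕ) : ℝ≥0) * δ.toNNReal = δ.toNNReal + v := by
      rw [hv]; push_cast; ring
    set f := heatH v (hatFn M k) with hfdef
    have hfm : Measurable f := heatH_measurable v _ (hatFn_measurable M k)
    have hfb : ∀ x, |f x| ≤ 1 := heatH_bound v _ 1 (hatFn_abs_le M k)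
    have hfp : Function.Periodic f 1 := fun x => by
      simp only [hfdef, heatH]
      congr 1; ext y
      rw [show x + 1 + y = x + y + 1 by ring, hatFn_periodic]
    rw [hvs, heatH_add _ _ _ (hatFn_measurable M k) 1 (hatFn_abs_le M k), pow_succ',
      Matrix.mul_apply, ← hfdef]
    set g : ℝ → ℝ := fun x => ∑ i : ZMod M, f ((i.val : ℝ) / M) * hatFn M i x with hg
    have herr : ∀ x, |f x - g x| ≤ (1 / M : ℝ) ^ 2 / v := fun x => by
      obtain ⟨θ, h0, h1, he⟩ := interp_formula M hM2 f hfp x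
      rw [hg]; simp only
      rw [he]
      exact interp_err v hv0 _ (hatFn_measurable M k) (hatFn_nonneg M k) (hatFn_le_one M k) x
        (1 / M) θ h0 h1 (by positivity)
    have hgm : Measurable g :=
      Finset.measurable_sum _ fun i _ => (hatFn_measurable M i).const_mul _
    have e1 : heatH δ.toNNReal f ((j.val : ℝ) / M) - heatH δ.toNNReal g ((j.val : ℝ) / M)
        = heatH δ.toNNReal (fun x => f x - g x) ((j.val : ℝ) / M) := by
      have i1 := integrable_bdd δ.toNNReal f hfm 1 hfb ((j.val : ℝ) / M)
      have i2 := integrable_bdd δ.toNNReal (fun x => f x - g x) (hfm.sub hgm) _ herr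
        ((j.val : ℝ) / M)
      have i3 : Integrable (fun y => g ((j.val : ℝ) / M + y)) (gaussianReal 0 δ.toNNReal) := by
        have := i1.sub i2
        refine this.congr (ae_of_all _ fun y => ?_)
        simp
      exact (integral_sub i1 i3).symm
    have b1 := heatH_bound δ.toNNReal (fun x => f x - g x) _ herr ((j.val : ℝ) / M)
    rw [← e1, hg, ← Qmat_sum_mul] at b1
    have b2 : |∑ i, Qmat M δ j i * (Qmat M δ ^ (n + 1)) i k
        - ∑ i, Qmat M δ j i * f ((i.val : ℝ) / M)| ≤ ((1 / M : ℝ) ^ 2 / δ) * (harmonic n : ℝ) := by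
      rw [← Finset.sum_sub_distrib]
      refine (Finset.abs_sum_le_sum_abs _ _).trans ?_
      calc _ ≤ ∑ i, Qmat M δ j i * (((1 / M : ℝ) ^ 2 / δ) * (harmonic n : ℝ)) := by
            apply Finset.sum_le_sum
            intro i _
            have hq : 0 ≤ Qmat M δ j i := heatH_nonneg _ _ (hatFn_nonneg M i) _
            rw [← mul_sub, abs_mul, abs_of_nonneg hq]
            exact mul_le_mul_of_nonneg_left (ih i) hq
        _ = _ := by rw [← Finset.sum_mul, Qmat_row_sum M hM2, one_mul]
    have hh : ((1 / M : ℝ) ^ 2 / δ) * (harmonic (n + 1) : ℝ)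
        = ((1 / M : ℝ) ^ 2 / δ) * (harmonic n : ℝ) + (1 / M : ℝ) ^ 2 / v := by
      rw [harmonic_succ, hvr]; push_cast; field_simp
    rw [hh]
    rw [abs_sub_comm] at b1
    have := abs_add_le (∑ i, Qmat M δ j i * (Qmat M δ ^ (n + 1)) i k
        - ∑ i, Qmat M δ j i * f ((i.val : ℝ) / M)) (∑ i, Qmat M δ j i * f ((i.val : ℝ) / M)
        - heatH δ.toNNReal f ((j.val : ℝ) / M))
    rw [sub_add_sub_cancel] at this
    linarith

/-- Lemma 4.3, first estimate (heat-kernel approximation of powers of `Q`): for every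
`T > 0` there is `C > 0` such that for `δt = T/M_T`, `δx = 1/M`, every `1 ≤ ℓ ≤ M_T - 1`
and all `j₁, j₂`,
`|(Q^{2ℓ})_{j₁,j₂} - ∫ φ_{j₁}(x_{j₂} + y) dγ_{2ℓδt}(y)| ≤ C (δx²/δt)(1 + |log δt|)`. -/
theorem Q_pow_heat_kernel_approx (T : ℝ) (hT : 0 < T) : ∃ C : ℝ, 0 < C ∧
    ∀ (MT : ℕ), 2 ≤ MT → ∀ (M : ℕ) [NeZero M], 2 ≤ M →
    ∀ (ℓ : ℕ), 1 ≤ ℓ → ℓ ≤ MT - 1 → ∀ (j₁ j₂ : ZMod M),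
      |(Qmat M (T / MT) ^ (2 * ℓ)) j₁ j₂
          - ∫ y, hatFn M j₁ ((j₂.val : ℝ) / M + y)
              ∂(gaussianReal 0 (2 * ℓ * (T / MT)).toNNReal)|
        ≤ C * ((1 / M : ℝ) ^ 2 / (T / MT)) * (1 + |Real.log (T / MT)|) := by
  refine ⟨1 + |Real.log (2 * T)|, by positivity, ?_⟩
  intro MT hMT M _ hM ℓ hl hl2 j₁ j₂
  have hMTp : (0 : ℝ) < MT := by exact_mod_cast (by omega : 0 < MT)
  have hMp : (0 : ℝ) < M := by exact_mod_cast NeZero.pos M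
  set δ : ℝ := T / MT with hδdef
  have hδ : 0 < δ := by positivity
  obtain ⟨n, hn⟩ : ∃ n, 2 * ℓ = n + 1 := ⟨2 * ℓ - 1, by omega⟩
  have hn0 : 0 < n := by omega
  have hnle : n ≤ 2 * MT := by omega
  have hvar : (2 * ℓ * δ).toNNReal = ((n + 1 : ℕ) : ℝ≥0) * δ.toNNReal := by
    rw [← hn, Real.toNNReal_mul (by positivity)]
    congr 1
    rw [show (2 * (ℓ : ℝ)) = ((2 * ℓ : ℕ) : ℝ) by push_cast; ring, Real.toNNReal_natCast]
  have hint : ∫ y, hatFn M j₁ ((j₂.val : ℝ) / M + y) ∂(gaussianReal 0 (2 * ℓ * δ).toNNReal)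
      = heatH (((n + 1 : ℕ) : ℝ≥0) * δ.toNNReal) (hatFn M j₂) ((j₁.val : ℝ) / M) := by
    rw [hvar]
    simp_rw [hatFn_symm M j₁ j₂]
    unfold heatH
    have hm := hatFn_measurable M j₂
    have e := gaussianReal_map_neg (μ := 0) (v := ((n + 1 : ℕ) : ℝ≥0) * δ.toNNReal)
    rw [neg_zero] at e
    conv_rhs => rw [← e]
    rw [integral_map (by fun_prop) (Measurable.aestronglyMeasurable (by fun_prop))]
  rw [hint, hn]
  refine (main_ind M hM δ hδ j₂ n j₁).trans ?_
  have h1 := harmonic_le_one_add_log n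
  have h2 : Real.log n ≤ Real.log (2 * MT) :=
    Real.log_le_log (by exact_mod_cast hn0) (by exact_mod_cast hnle)
  have h3 : Real.log (2 * MT) = Real.log (2 * T) - Real.log δ := by
    rw [← Real.log_div (by positivity) hδ.ne', hδdef]
    congr 1
    field_simp
  have h4 := le_abs_self (Real.log (2 * T))
  have h5 := neg_abs_le (Real.log δ)
  have h6 : (harmonic n : ℝ) ≤ (1 + |Real.log (2 * T)|) * (1 + |Real.log δ|) := by
    nlinarith [abs_nonneg (Real.log (2 * T)), abs_nonneg (Real.log δ),
      mul_nonneg (abs_nonneg (Real.log (2 * T))) (abs_nonneg (Real.log δ))]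
  calc _ ≤ ((1 / M : ℝ) ^ 2 / δ) * ((1 + |Real.log (2 * T)|) * (1 + |Real.log δ|)) :=
        mul_le_mul_of_nonneg_left h6 (by positivity)
    _ = _ := by ring
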